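/- arXiv:1202.1022 — 2 statements merged into one kernel-verified Lean document; each statement's English description precedes it below -/
import Mathlib

section
/- The infimum over t ∈ (0, π] of the function t ↦ 4·(sin t)²/(t − sin t·cos t) + π·√(2·(t − sin t·cos t)) equals √2·π^(3/2), and this infimum is attained at t = π. -/
open Real

lemma aux_nonneg (f f' : ℝ → ℝ) (h0 : f 0 = 0) (hd : ∀ x, HasDerivAt f (f' x) x)
    (hp : ∀ x, 0 ≤ x → 0 ≤ f' x) : ∀ x, 0 ≤ x → 0 ≤ f x := by
  intro x hx
  have hm : MonotoneOn f (Set.Ici 0) := by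
    apply monotoneOn_of_deriv_nonneg (convex_Ici 0)
    · exact fun y _ => (hd y).continuousAt.continuousWithinAt
    · exact fun y _ => (hd y).differentiableAt.differentiableWithinAt
    · intro y hy
      rw [interior_Ici] at hy
      rw [(hd y).deriv]
      exact hp y (le_of_lt hy)
  have := hm (Set.mem_Ici.2 le_rfl) (Set.mem_Ici.2 hx) hx
  rwa [h0] at this

lemma sinStep (p p' : ℝ → ℝ) (s : ℝ) (h0 : p 0 = 0) (hd : ∀ x, HasDerivAt p (p' x) x)
    (hp : ∀ x, 0 ≤ x → 0 ≤ s * (p' x - cos x)) : ∀ x, 0 ≤ x → 0 ≤ s * (p x - sin x) := by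
  apply aux_nonneg _ (fun x => s * (p' x - cos x)) (by simp [h0]) _ hp
  exact fun x => ((hd x).sub (hasDerivAt_sin x)).const_mul s

lemma cosStep (p p' : ℝ → ℝ) (s : ℝ) (h0 : p 0 = 1) (hd : ∀ x, HasDerivAt p (-p' x) x)
    (hp : ∀ x, 0 ≤ x → 0 ≤ s * (p' x - sin x)) : ∀ x, 0 ≤ x → 0 ≤ (-s) * (p x - cos x) := by
  apply aux_nonneg _ (fun x => s * (p' x - sin x)) (by simp [h0]) _ hp
  intro x
  have := ((hd x).sub (hasDerivAt_cos x)).const_mul (-s)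
  exact this.congr_deriv (by ring)

lemma dpow (x : ℝ) (n : ℕ) : HasDerivAt (fun y : ℝ => y ^ n) (n * x ^ (n - 1)) x := hasDerivAt_pow n x

lemma taylor (v : ℝ) (hv : 0 ≤ v) :
    v - v^3/6 + v^5/120 - v^7/5040 ≤ sin v ∧
    cos v ≤ 1 - v^2/2 + v^4/24 - v^6/720 + v^8/40320 := by
  have c0 : ∀ x : ℝ, 0 ≤ x → 0 ≤ (1:ℝ) * ((fun _ => (1:ℝ)) x - cos x) := by
    intro x _; have := cos_le_one x; simp; exact this
  have s1 := sinStep (fun x => x) _ 1 rfl (fun x => hasDerivAt_id x) c0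
  have c2 := cosStep (fun x => 1 - x^2/2) _ 1 (by simp) (fun x => by
    exact HasDerivAt.congr_deriv (((dpow x 2).div_const 2).const_sub 1) (by push_cast; norm_num; try ring)) s1
  have s3 := sinStep (fun x => x - x^3/6) _ (-1) (by simp) (fun x => by
    exact HasDerivAt.congr_deriv ((hasDerivAt_id x).sub ((dpow x 3).div_const 6)) (by push_cast; norm_num; try ring)) c2
  have c4 := cosStep (fun x => 1 - x^2/2 + x^4/24) _ (-1) (by simp) (fun x => by
    exact HasDerivAt.congr_deriv ((((dpow x 2).div_const 2).const_sub 1).add ((dpow x 4).div_const 24)) (by push_cast; norm_num; try ring)) s3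
  have s5 := sinStep (fun x => x - x^3/6 + x^5/120) _ (- -1) (by simp) (fun x => by
    exact HasDerivAt.congr_deriv (((hasDerivAt_id x).sub ((dpow x 3).div_const 6)).add ((dpow x 5).div_const 120)) (by push_cast; norm_num; try ring)) c4
  have c6 := cosStep (fun x => 1 - x^2/2 + x^4/24 - x^6/720) _ (- -1) (by simp) (fun x => by
    exact HasDerivAt.congr_deriv (((((dpow x 2).div_const 2).const_sub 1).add ((dpow x 4).div_const 24)).sub
      ((dpow x 6).div_const 720)) (by push_cast; norm_num; try ring)) s5
  have s7 := sinStep (fun x => x - x^3/6 + x^5/120 - x^7/5040) _ (- - -1) (by simp) (fun x => by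
    exact HasDerivAt.congr_deriv ((((hasDerivAt_id x).sub ((dpow x 3).div_const 6)).add ((dpow x 5).div_const 120)).sub
      ((dpow x 7).div_const 5040)) (by push_cast; norm_num; try ring)) c6
  have c8 := cosStep (fun x => 1 - x^2/2 + x^4/24 - x^6/720 + x^8/40320) _ (- - -1) (by simp)
    (fun x => by
    exact HasDerivAt.congr_deriv ((((((dpow x 2).div_const 2).const_sub 1).add ((dpow x 4).div_const 24)).sub
      ((dpow x 6).div_const 720)).add ((dpow x 8).div_const 40320)) (by push_cast; norm_num; try ring)) s7
  have h1 := s7 v hv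
  have h2 := c8 v hv
  constructor <;> linarith

lemma poly1 (v : ℝ) (h0 : 0 ≤ v) (h1 : v ≤ 1) :
    1.97 * (v^3/6 - v^5/120 + v^7/5040) ≤ v^2/2 - v^4/24 + v^6/720 - v^8/40320 := by
  have : 0 ≤ v^2 * (1/2 - v^2/24 - v^6/40320 - 1.97*(v/6 + v^5/5040)) := by
    have h2 : v^2 ≤ 1 := pow_le_one₀ h0 h1
    have h5 : v^5 ≤ 1 := pow_le_one₀ h0 h1
    have h6 : v^6 ≤ 1 := pow_le_one₀ h0 h1
    apply mul_nonneg (by positivity)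
    linarith
  have : 0 ≤ v^5 := by positivity
  have : 0 ≤ v^6 := by positivity
  nlinarith

lemma poly2 (v : ℝ) (h0 : 1 ≤ v) (h1 : v ≤ 2) :
    0.2293 + 0.985 * (v^3/6 - v^5/120 + v^7/5040) ≤ v^2/2 - v^4/24 + v^6/720 - v^8/40320 := by
  obtain ⟨a, rfl⟩ : ∃ a, v = 1 + a := ⟨v - 1, by ring⟩
  have ha : 0 ≤ a := by linarith
  have hb : 0 ≤ 1 - a := by linarith
  have e (i j : ℕ) : 0 ≤ a^i * (1-a)^j := by positivity
  nlinarith [e 0 8, e 1 7, e 2 6, e 3 5, e 4 4, e 5 3, e 6 2, e 7 1, e 8 0]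

lemma poly3 (v : ℝ) (h0 : 2 ≤ v) (h1 : v ≤ 2.6) :
    0.77375 + 0.4925 * (v^3/6 - v^5/120 + v^7/5040) ≤ v^2/2 - v^4/24 + v^6/720 - v^8/40320 := by
  obtain ⟨a, rfl⟩ : ∃ a, v = 2 + 0.6 * a := ⟨(v - 2)/0.6, by ring⟩
  have ha : 0 ≤ a := by linarith
  have hb : 0 ≤ 1 - a := by linarith
  have e (i j : ℕ) : 0 ≤ a^i * (1-a)^j := by positivity
  nlinarith [e 0 8, e 1 7, e 2 6, e 3 5, e 4 4, e 5 3, e 6 2, e 7 1, e 8 0]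

lemma trig (z : ℝ) (h0 : 0 ≤ z) :
    (z ≤ 0.5 → 1.97 * (z - sin z * cos z) ≤ sin z ^ 2) ∧
    (0.5 ≤ z → z ≤ 1 → 0.11465 + 0.985 * (z - sin z * cos z) ≤ sin z ^ 2) ∧
    (1 ≤ z → z ≤ 1.3 → 0.386875 + 0.4925 * (z - sin z * cos z) ≤ sin z ^ 2) := by
  obtain ⟨hs, hc⟩ := taylor (2*z) (by linarith)
  have e1 := sin_two_mul z
  have e2 := cos_two_mul z
  have e3 := sin_sq_add_cos_sq z
  refine ⟨fun h => ?_, fun h h' => ?_, fun h h' => ?_⟩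
  · have := poly1 (2*z) (by linarith) (by linarith)
    linarith
  · have := poly2 (2*z) (by linarith) (by linarith)
    linarith
  · have := poly3 (2*z) (by linarith) (by linarith)
    linarith

lemma u_nonneg (z : ℝ) (h0 : 0 < z) : 0 < z - sin z * cos z := by
  have := sin_lt (x := 2*z) (by linarith)
  rw [sin_two_mul] at this
  linarith

lemma tangent (x a : ℝ) (hx : 0 ≤ x) (ha : 0 ≤ a) : x^2 - x^3 ≤ a^3/2 + (1-1.5*a)*x^2 := by
  have : 0 ≤ (x-a)^2*(x+a/2) := by positivity
  nlinarith

lemma core (t x K L : ℝ) (ht : 0 < t) (ht' : t ≤ π) (hx : 0 ≤ x) (hK : K ≤ 6.19) (hL0 : 0 ≤ L)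
    (hL : L ≤ 1.97) (hKL : K = π * L) (hu : t - sin t * cos t = π * x^2) :
    K * (x^2 - x^3) ≤ sin t ^ 2 := by
  have hpi := pi_pos
  have hK0 : 0 ≤ K := by rw [hKL]; positivity
  have key (a : ℝ) (ha : 0 ≤ a) := mul_le_mul_of_nonneg_left (tangent x a hx ha) hK0
  have hKu : K * x^2 = L * (t - sin t * cos t) := by rw [hKL, hu]; ring
  have hLu : L * (t - sin t * cos t) ≤ 1.97 * (t - sin t * cos t) :=
    mul_le_mul_of_nonneg_right hL (u_nonneg t ht).le
  have hKw : K * (1 - x^2) = L * ((π - t) - sin (π - t) * cos (π - t)) := by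
    rw [sin_pi_sub, cos_pi_sub, mul_sub, hKu, hKL]; ring
  by_cases c1 : t ≤ 1.3
  · obtain ⟨p1, p2, p3⟩ := trig t ht.le
    by_cases c2 : t ≤ 0.5
    · have := key 0 (by norm_num)
      have := p1 c2
      linarith
    by_cases c3 : t ≤ 1
    · have := key (1/3) (by norm_num)
      have := p2 (by linarith) c3
      linarith
    · have := key (1/2) (by norm_num)
      have := p3 (by linarith) c1
      linarith
  by_cases c4 : π - t ≤ 1.3
  · obtain ⟨p1, p2, p3⟩ := trig (π - t) (by linarith)
    have hw0 : 0 ≤ (π - t) - sin (π - t) * cos (π - t) := by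
      rcases ht'.lt_or_eq with h | h
      · exact (u_nonneg _ (by linarith)).le
      · simp [h]
    have hLw : L * ((π - t) - sin (π - t) * cos (π - t)) ≤
        1.97 * ((π - t) - sin (π - t) * cos (π - t)) := mul_le_mul_of_nonneg_right hL hw0
    rw [sin_pi_sub] at *
    by_cases c2 : π - t ≤ 0.5
    · have := key 1 (by norm_num)
      have := p1 c2
      linarith
    by_cases c3 : π - t ≤ 1
    · have := key 1 (by norm_num)
      have := p2 (by linarith) c3
      linarith
    · have := key (5/6) (by norm_num)
      have := p3 (by linarith) c4
      linarith
  · have := key (2/3) (by norm_num)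
    have h1 := one_sub_sq_div_two_le_cos (x := π/2 - t)
    rw [cos_pi_div_two_sub] at h1
    have h2 := pi_lt_d4
    have h3 : (π/2 - t)^2 ≤ 0.2708^2 := by
      apply sq_le_sq'  <;> linarith
    have : 0.963 ≤ sin t := by linarith
    nlinarith

lemma val : √2 * π ^ ((3:ℝ)/2) = π * √(2*π) := by
  rw [show (3:ℝ)/2 = 1 + 1/2 by norm_num, rpow_add pi_pos, rpow_one, ← sqrt_eq_rpow,
    sqrt_mul (by norm_num)]
  ring

lemma lower (t : ℝ) (ht : 0 < t) (ht' : t ≤ π) :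
    π * √(2*π) ≤ 4 * sin t ^ 2 / (t - sin t * cos t) + π * √(2 * (t - sin t * cos t)) := by
  have hu := u_nonneg t ht
  set u := t - sin t * cos t with hudef
  have hpi := pi_pos
  have hpi4 := pi_lt_d4
  have hq : 0 < √(2*π) := sqrt_pos.2 (by positivity)
  have hq2 : √(2*π)^2 = 2*π := sq_sqrt (by positivity)
  have hr2 : √(2*u)^2 = 2*u := sq_sqrt (by positivity)
  have hr : 0 ≤ √(2*u) := sqrt_nonneg _
  set q := √(2*π)
  set r := √(2*u)
  have hq' : q ≤ 2.507 := by nlinarith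
  have hL : π * q / 4 ≤ 1.9692 := by nlinarith
  have hL0 : 0 ≤ π * q / 4 := by positivity
  have hK : π * (π * q / 4) ≤ 6.19 := by nlinarith
  have hx2 : u = π * (r/q)^2 := by
    rw [div_pow, hq2, hr2]; field_simp
  have := core t (r/q) _ _ ht ht' (by positivity) hK hL0 (by linarith) rfl (by rw [← hudef]; exact hx2)
  have e : π * (π * q / 4) * ((r/q)^2 - (r/q)^3) = π * u * (q - r) / 4 := by
    rw [hx2]; field_simp
  rw [e] at this
  have : π * q - π * r ≤ 4 * sin t ^ 2 / u := by
    rw [le_div_iff₀ hu]; linarith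
  linarith

theorem stmt1 :
    sInf ((fun t : ℝ =>
        4 * (Real.sin t) ^ 2 / (t - Real.sin t * Real.cos t)
          + π * Real.sqrt (2 * (t - Real.sin t * Real.cos t))) '' Set.Ioc 0 π)
      = Real.sqrt 2 * π ^ ((3 : ℝ) / 2)
    ∧ 4 * (Real.sin π) ^ 2 / (π - Real.sin π * Real.cos π)
        + π * Real.sqrt (2 * (π - Real.sin π * Real.cos π))
      = Real.sqrt 2 * π ^ ((3 : ℝ) / 2) := by
  have h2 : 4 * (Real.sin π) ^ 2 / (π - Real.sin π * Real.cos π)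
        + π * Real.sqrt (2 * (π - Real.sin π * Real.cos π))
      = Real.sqrt 2 * π ^ ((3 : ℝ) / 2) := by
    rw [val]; simp
  refine ⟨IsLeast.csInf_eq ⟨⟨π, ⟨pi_pos, le_rfl⟩, h2⟩, ?_⟩, h2⟩
  rintro _ ⟨t, ⟨h0, h1⟩, rfl⟩
  rw [val]
  exact lower t h0 h1
end

section
/- For every real number v ≥ 16 and every t with 0 < t < π, one has (2·(sin t)²·v)/(t − sin t·cos t) + 2·√π·√v·√(2π·(t − sin t·cos t)) ≥ (2π)^(3/2)·√v. -/
open Real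

/-- The auxiliary function attains its minimum over an interval at an endpoint. -/
lemma aux_endpoint (p r a b t e : ℝ) (hp : 0 < p) (ha : 0 ≤ a) (hb : b ≤ π) (hat : a ≤ t)
    (htb : t ≤ b) (ht0 : 0 < t) (htpi : t < π)
    (h1 : e ≤ p * sin a ^ 2 + r * (a - sin a * cos a))
    (h2 : e ≤ p * sin b ^ 2 + r * (b - sin b * cos b)) :
    e ≤ p * sin t ^ 2 + r * (t - sin t * cos t) := by
  have hd : ∀ x : ℝ, HasDerivAt (fun x => p * sin x ^ 2 + r * (x - sin x * cos x))
      (2 * sin x * (p * cos x + r * sin x)) x := by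
    intro x
    have h := ((((hasDerivAt_sin x).pow 2).const_mul p).add
      (((hasDerivAt_id x).sub ((hasDerivAt_sin x).mul (hasDerivAt_cos x))).const_mul r))
    refine h.congr_deriv ?_
    simp only [Nat.cast_ofNat, Nat.add_one_sub_one, pow_one]
    linear_combination (-r) * (sin_sq_add_cos_sq x)
  have hst : 0 < sin t := sin_pos_of_pos_of_lt_pi ht0 htpi
  have hc : Continuous (fun x => p * sin x ^ 2 + r * (x - sin x * cos x)) := by fun_prop
  rcases le_total 0 (p * cos t + r * sin t) with hs | hs
  · have hm : MonotoneOn (fun x => p * sin x ^ 2 + r * (x - sin x * cos x)) (Set.Icc a t) := by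
      apply monotoneOn_of_deriv_nonneg (convex_Icc a t) hc.continuousOn
      · exact fun x _ => (hd x).differentiableAt.differentiableWithinAt
      · intro x hx
        rw [interior_Icc] at hx
        rw [(hd x).deriv]
        have hsx : 0 ≤ sin x := sin_nonneg_of_nonneg_of_le_pi (by linarith [hx.1]) (by linarith [hx.2])
        have hdiff : 0 ≤ sin (t - x) :=
          sin_nonneg_of_nonneg_of_le_pi (by linarith [hx.2]) (by linarith [hx.1])
        rw [sin_sub] at hdiff
        have : 0 ≤ sin t * (p * cos x + r * sin x) := by
          nlinarith [mul_nonneg hsx hs, mul_nonneg hp.le hdiff]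
        have := nonneg_of_mul_nonneg_right this hst
        positivity
    have := hm ⟨le_refl a, hat⟩ ⟨hat, le_refl t⟩ hat
    simp only at this
    linarith
  · have hm : AntitoneOn (fun x => p * sin x ^ 2 + r * (x - sin x * cos x)) (Set.Icc t b) := by
      apply antitoneOn_of_deriv_nonpos (convex_Icc t b) hc.continuousOn
      · exact fun x _ => (hd x).differentiableAt.differentiableWithinAt
      · intro x hx
        rw [interior_Icc] at hx
        rw [(hd x).deriv]
        have hsx : 0 ≤ sin x := sin_nonneg_of_nonneg_of_le_pi (by linarith [hx.1]) (by linarith [hx.2])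
        have hdiff : 0 ≤ sin (x - t) :=
          sin_nonneg_of_nonneg_of_le_pi (by linarith [hx.1]) (by linarith [hx.2])
        rw [sin_sub] at hdiff
        have : 0 ≤ sin t * (-(p * cos x + r * sin x)) := by
          nlinarith [mul_nonneg hsx (neg_nonneg.2 hs), mul_nonneg hp.le hdiff]
        have := nonneg_of_mul_nonneg_right this hst
        nlinarith [mul_nonneg hsx this]
    have := hm ⟨le_refl t, htb⟩ ⟨htb, le_refl b⟩ htb
    simp only at this
    linarith

lemma aux_endpoint' (p k u a b t : ℝ) (hp : 0 < p) (ha : 0 ≤ a) (hb : b ≤ π) (hat : a ≤ t)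
    (htb : t ≤ b) (ht0 : 0 < t) (htpi : t < π)
    (h1 : 0 ≤ p * sin a ^ 2 + k * (1.5 * u - 1) * (a - sin a * cos a) - k * π * u ^ 3 / 2)
    (h2 : 0 ≤ p * sin b ^ 2 + k * (1.5 * u - 1) * (b - sin b * cos b) - k * π * u ^ 3 / 2) :
    0 ≤ p * sin t ^ 2 + k * (1.5 * u - 1) * (t - sin t * cos t) - k * π * u ^ 3 / 2 := by
  have := aux_endpoint p (k * (1.5 * u - 1)) a b t (k * π * u ^ 3 / 2) hp ha hb hat htb ht0 htpi
    (by linarith) (by linarith)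
  linarith

set_option maxHeartbeats 4000000 in
lemma exists_tangent (t : ℝ) (ht0 : 0 < t) (htpi : t < π) : ∃ u : ℝ, 0 ≤ u ∧
    0 ≤ 2 * √2 * sin t ^ 2 + (π * √π) * (1.5 * u - 1) * (t - sin t * cos t)
      - (π * √π) * π * u ^ 3 / 2 := by
  have p1 := pi_gt_d4
  have p2 := pi_lt_d4
  have q1 : (1.7724 : ℝ) ≤ √π := le_sqrt_of_sq_le (by norm_num; linarith)
  have q2 : √π ≤ (1.7725 : ℝ) := (sqrt_le_left (by norm_num)).2 (by norm_num; linarith)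
  have r1 : (1.4142 : ℝ) ≤ √2 := le_sqrt_of_sq_le (by norm_num)
  have r2 : √2 ≤ (1.4143 : ℝ) := (sqrt_le_left (by norm_num)).2 (by norm_num)
  have w1 : (1.732 : ℝ) ≤ √3 := le_sqrt_of_sq_le (by norm_num)
  have w2 : √3 ≤ (1.7321 : ℝ) := (sqrt_le_left (by norm_num)).2 (by norm_num)
  have w3 : √3 ^ 2 = 3 := sq_sqrt (by norm_num)
  have k1 : (5.5679 : ℝ) ≤ π * √π := by nlinarith
  have k2 : π * √π ≤ (5.569 : ℝ) := by nlinarith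
  set k := π * √π with hk
  have hp : 0 < 2 * √2 := by positivity
  have l1 : k * π ≤ 17.496 := by nlinarith
  have l2 : 17.49 ≤ k * π := by nlinarith
  have E4 : sin (π / 6) = 1 / 2 ∧ cos (π / 6) = √3 / 2 := ⟨sin_pi_div_six, cos_pi_div_six⟩
  have E8 : sin (π / 3) = √3 / 2 ∧ cos (π / 3) = 1 / 2 := ⟨sin_pi_div_three, cos_pi_div_three⟩
  have E16 : sin (2 * π / 3) = √3 / 2 ∧ cos (2 * π / 3) = - (1 / 2) := by
    rw [show 2 * π / 3 = π - π / 3 by ring, sin_pi_sub, cos_pi_sub, E8.1, E8.2]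
    exact ⟨rfl, rfl⟩
  have E20 : sin (5 * π / 6) = 1 / 2 ∧ cos (5 * π / 6) = - (√3 / 2) := by
    rw [show 5 * π / 6 = π - π / 6 by ring, sin_pi_sub, cos_pi_sub, E4.1, E4.2]
    exact ⟨rfl, rfl⟩
  have E10s : sin (5 * π / 12) * cos (5 * π / 12) = 1 / 4 := by
    have h := sin_two_mul (5 * π / 12)
    rw [show 2 * (5 * π / 12) = 5 * π / 6 by ring, E20.1] at h
    linarith
  have E10c : sin (5 * π / 12) ^ 2 = (2 + √3) / 4 := by
    have h := cos_two_mul (5 * π / 12)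
    rw [show 2 * (5 * π / 12) = 5 * π / 6 by ring, E20.2] at h
    have := sin_sq_add_cos_sq (5 * π / 12)
    linarith
  -- values of sin² and of `x - sin x cos x` at the breakpoints
  have S4 : sin (π / 6) ^ 2 = 1 / 4 := by rw [E4.1]; norm_num
  have S8 : sin (π / 3) ^ 2 = 3 / 4 := by rw [E8.1, div_pow, w3]; norm_num
  have S16 : sin (2 * π / 3) ^ 2 = 3 / 4 := by rw [E16.1, div_pow, w3]; norm_num
  have A4 : π / 6 - sin (π / 6) * cos (π / 6) = π / 6 - √3 / 4 := by rw [E4.1, E4.2]; ring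
  have A8 : π / 3 - sin (π / 3) * cos (π / 3) = π / 3 - √3 / 4 := by rw [E8.1, E8.2]; ring
  have A16 : 2 * π / 3 - sin (2 * π / 3) * cos (2 * π / 3) = 2 * π / 3 + √3 / 4 := by
    rw [E16.1, E16.2]; ring
  have kw1 : k * √3 ≤ 5.569 * 1.7321 := by nlinarith
  have kw2 : 5.5679 * 1.732 ≤ k * √3 := by nlinarith
  have rw1 : 1.4142 * 1.732 ≤ √2 * √3 := by nlinarith
  rcases le_total t (π / 6) with h4 | h4
  · refine ⟨0, le_refl _, aux_endpoint' _ _ _ 0 (π / 6) t hp (le_refl _) (by linarith) ht0.le h4 ht0 htpi ?_ ?_⟩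
    · simp
    · rw [S4, A4]; linarith
  rcases le_total t (π / 3) with h8 | h8
  · refine ⟨0.34, by norm_num, aux_endpoint' _ _ _ (π / 6) (π / 3) t hp (by linarith) (by linarith) h4 h8 ht0 htpi ?_ ?_⟩
    · rw [S4, A4]; linarith
    · rw [S8, A8]; linarith
  rcases le_total t (5 * π / 12) with h10 | h10
  · refine ⟨0.53, by norm_num, aux_endpoint' _ _ _ (π / 3) (5 * π / 12) t hp (by linarith) (by linarith) h8 h10 ht0 htpi ?_ ?_⟩
    · rw [S8, A8]; linarith
    · rw [E10c, E10s]; linarith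
  rcases le_total t (π / 2) with h12 | h12
  · refine ⟨0.62, by norm_num, aux_endpoint' _ _ _ (5 * π / 12) (π / 2) t hp (by linarith) (by linarith) h10 h12 ht0 htpi ?_ ?_⟩
    · rw [E10c, E10s]; linarith
    · rw [sin_pi_div_two, cos_pi_div_two]; linarith
  rcases le_total t (2 * π / 3) with h16 | h16
  · refine ⟨0.76, by norm_num, aux_endpoint' _ _ _ (π / 2) (2 * π / 3) t hp (by linarith) (by linarith) h12 h16 ht0 htpi ?_ ?_⟩
    · rw [sin_pi_div_two, cos_pi_div_two]; linarith
    · rw [S16, A16]; linarith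
  · refine ⟨1, by norm_num, aux_endpoint' _ _ _ (2 * π / 3) π t hp (by linarith) (le_refl _) h16 htpi.le ht0 htpi ?_ ?_⟩
    · rw [S16, A16]; linarith
    · rw [sin_pi, cos_pi]; apply le_of_eq; ring

theorem stmt2 (v t : ℝ) (hv : 16 ≤ v) (ht0 : 0 < t) (htpi : t < π) :
    (2 * (Real.sin t) ^ 2 * v) / (t - Real.sin t * Real.cos t)
      + 2 * Real.sqrt π * Real.sqrt v * Real.sqrt (2 * π * (t - Real.sin t * Real.cos t))
    ≥ (2 * π) ^ ((3 : ℝ) / 2) * Real.sqrt v := by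
  obtain ⟨u, hu, h⟩ := exists_tangent t ht0 htpi
  have hA : 0 < t - sin t * cos t := by
    have h1 := sin_lt (show 0 < 2 * t by linarith)
    rw [sin_two_mul] at h1
    linarith
  set A := t - sin t * cos t with hAdef
  have hpi := pi_pos
  have hq : √π ^ 2 = π := sq_sqrt hpi.le
  have hy : √A ^ 2 = A := sq_sqrt hA.le
  have hqp : 0 < √π := sqrt_pos.2 hpi
  have hyp : 0 < √A := sqrt_pos.2 hA
  have hr : √2 ^ 2 = 2 := sq_sqrt (by norm_num)
  have hrp : 0 < √2 := sqrt_pos.2 (by norm_num)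
  have hw : √v ^ 2 = v := sq_sqrt (by linarith)
  have hw4 : 4 ≤ √v := le_sqrt_of_sq_le (by norm_num; linarith)
  have hpow : (2 * π) ^ ((3 : ℝ) / 2) = 2 * π * (√2 * √π) := by
    rw [show (3 : ℝ) / 2 = 1 + 1 / 2 by norm_num, rpow_add (by positivity), rpow_one,
      ← sqrt_eq_rpow, sqrt_mul (by norm_num)]
  rw [hpow, sqrt_mul (by positivity), sqrt_mul (by norm_num)]
  have core : π * √π * A ≤ 2 * √2 * sin t ^ 2 + π * (A * √A) := by
    have hm : 0 ≤ (√A - u * √π) ^ 2 * (2 * √A + u * √π) := by positivity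
    have e : (√A - u * √π) ^ 2 * (2 * √A + u * √π)
        = 2 * (A * √A) - 3 * (u * √π) * A + u ^ 3 * (π * √π) := by
      linear_combination (2 * √A - 3 * u * √π) * hy + u ^ 3 * √π * hq
    rw [e] at hm
    nlinarith [mul_nonneg hpi.le hm]
  have core2 : 2 * π * (√2 * √π) ≤ 8 * sin t ^ 2 / A + 2 * √2 * π * √A := by
    rw [← sub_le_iff_le_add, le_div_iff₀ hA]
    have := mul_le_mul_of_nonneg_left core (by positivity : 0 ≤ 2 * √2)
    nlinarith
  have e1 : 8 * sin t ^ 2 / A * √v ≤ 2 * sin t ^ 2 * v / A := by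
    rw [div_mul_eq_mul_div]
    apply div_le_div_of_nonneg_right _ hA.le
    nlinarith [mul_nonneg (sq_nonneg (sin t)) (mul_nonneg (sub_nonneg.2 hw4) (sqrt_nonneg v))]
  have e2 : 2 * √π * √v * (√2 * √π * √A) = 2 * √2 * π * √A * √v := by
    linear_combination 2 * √v * √2 * √A * hq
  rw [e2]
  nlinarith [mul_le_mul_of_nonneg_right core2 (sqrt_nonneg v)]
end
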